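/- Let (X, hgt) be a quasiparabolic W-set, let I ⊆ S, and let W_I be the standard parabolic subgroup generated by I. Suppose x, y ∈ X lie in the same W_I-orbit and the heights on that orbit are bounded below. Then x ≤ y in the Bruhat order of X (generated by all reflections of W) if and only if x ≤ y in the Bruhat order of the restricted quasiparabolic W_I-set, i.e., in the order generated by the reflections of W lying in W_I. -/

import Mathlib

open CoxeterSystem

variable {B W : Type*} [Group W] {M : CoxeterMatrix B}

/-- A scaled `W`-set: heights change by at most 1 under simple reflections. -/
def IsScaled (cs : CoxeterSystem M W) {X : Type*} [MulAction W X] (hgt : X → ℤ) : Prop :=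
  ∀ (b : B) (x : X), |hgt (cs.simple b • x) - hgt x| ≤ 1

/-- A quasiparabolic `W`-set: scaled, plus (QP1) and (QP2). -/
def IsQuasiparabolic (cs : CoxeterSystem M W) {X : Type*} [MulAction W X] (hgt : X → ℤ) : Prop :=
  IsScaled cs hgt ∧
  (∀ (r : W) (x : X), cs.IsReflection r → hgt (r • x) = hgt x → r • x = x) ∧
  (∀ (r : W) (b : B) (x : X), cs.IsReflection r → hgt x < hgt (r • x) →
    hgt (cs.simple b • r • x) < hgt (cs.simple b • x) → r • x = cs.simple b • x)
/-- The Bruhat order on a quasiparabolic `W`-set: the reflexive–transitive closure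
of the relation `x ≺ r • x` for reflections `r` with `hgt x < hgt (r • x)`. -/
def BruhatLE (cs : CoxeterSystem M W) {X : Type*} [MulAction W X] (hgt : X → ℤ) :
    X → X → Prop :=
  Relation.ReflTransGen (fun x y => ∃ r : W, cs.IsReflection r ∧ y = r • x ∧ hgt x < hgt y)

/-- The strict Bruhat order. -/
def BruhatLT (cs : CoxeterSystem M W) {X : Type*} [MulAction W X] (hgt : X → ℤ)
    (x y : X) : Prop :=
  BruhatLE cs hgt x y ∧ x ≠ y

/-- The Bruhat order restricted to a parabolic subgroup: the reflexive–transitive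
closure of `x ≺ r • x` for reflections `r` lying in the parabolic subgroup. -/
def BruhatLERestricted (cs : CoxeterSystem M W) (P : Subgroup W) {X : Type*}
    [MulAction W X] (hgt : X → ℤ) : X → X → Prop :=
  Relation.ReflTransGen
    (fun x y => ∃ r : W, cs.IsReflection r ∧ r ∈ P ∧ y = r • x ∧ hgt x < hgt y)

theorem bruhatLERestricted_top (cs : CoxeterSystem M W) {X : Type*} [MulAction W X]
    (hgt : X → ℤ) : BruhatLERestricted cs ⊤ hgt = BruhatLE cs hgt := by
  simp [BruhatLERestricted, BruhatLE]

namespace BruhatLERestricted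

variable {cs : CoxeterSystem M W} {X : Type*} [MulAction W X] {hgt : X → ℤ} {P Q : Subgroup W}
  {x y : X} {b : B}

theorem mono (hPQ : P ≤ Q) (h : BruhatLERestricted cs P hgt x y) :
    BruhatLERestricted cs Q hgt x y :=
  Relation.ReflTransGen.mono (fun _ _ ⟨r, hr, hrP, h⟩ => ⟨r, hr, hPQ hrP, h⟩) _ _ h

theorem eq_or_hgt_lt (h : BruhatLERestricted cs P hgt x y) : x = y ∨ hgt x < hgt y := by
  induction h with
  | refl => exact .inl rfl
  | tail _ hstep ih =>
    obtain ⟨r, -, -, -, hlt⟩ := hstep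
    rcases ih with rfl | ih
    · exact .inr hlt
    · exact .inr (ih.trans hlt)

theorem simple_smul_self (hqp : IsQuasiparabolic cs hgt) (hb : cs.simple b ∈ P)
    (h : hgt x ≤ hgt (cs.simple b • x)) : BruhatLERestricted cs P hgt x (cs.simple b • x) := by
  rcases h.lt_or_eq with h | h
  · exact .single ⟨_, cs.isReflection_simple b, hb, rfl, h⟩
  · rw [hqp.2.1 _ x (cs.isReflection_simple b) h.symm]
    exact .refl

theorem self_simple_smul (hqp : IsQuasiparabolic cs hgt) (hb : cs.simple b ∈ P)
    (h : hgt (cs.simple b • x) ≤ hgt x) : BruhatLERestricted cs P hgt (cs.simple b • x) x := by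
  have hss : cs.simple b • cs.simple b • x = x := by simp [smul_smul]
  have key := simple_smul_self (x := cs.simple b • x) hqp hb (by rwa [hss])
  rwa [hss] at key

/-- Acting by a simple reflection preserves each generating relation of the Bruhat order, unless
it swaps the two elements. -/
theorem eq_or_smul_step (hqp : IsQuasiparabolic cs hgt) (hb : cs.simple b ∈ P)
    (h : ∃ r : W, cs.IsReflection r ∧ r ∈ P ∧ y = r • x ∧ hgt x < hgt y) :
    y = cs.simple b • x ∨ ∃ r : W, cs.IsReflection r ∧ r ∈ P ∧
      cs.simple b • y = r • cs.simple b • x ∧ hgt (cs.simple b • x) < hgt (cs.simple b • y) := by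
  obtain ⟨r, hr, hrP, rfl, hlt⟩ := h
  have hconj : cs.simple b • r • x =
      (cs.simple b * r * (cs.simple b)⁻¹) • cs.simple b • x := by simp [smul_smul]
  have hrefl := hr.conj (cs.simple b)
  rcases lt_trichotomy (hgt (cs.simple b • x)) (hgt (cs.simple b • r • x)) with h | h | h
  · exact .inr ⟨_, hrefl, P.mul_mem (P.mul_mem hb hrP) (P.inv_mem hb), hconj, h⟩
  · have hfix := hqp.2.1 _ _ hrefl (by rw [← hconj, h])
    rw [← hconj, smul_left_cancel_iff] at hfix
    rw [hfix] at hlt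
    exact absurd hlt (lt_irrefl _)
  · exact .inl (hqp.2.2 r b x hr hlt h)

/-- Lifting property: a simple reflection weakly lowering `y` can be applied to `x` in `x ≤ y`. -/
theorem smul_le (hqp : IsQuasiparabolic cs hgt) (hb : cs.simple b ∈ P)
    (h : BruhatLERestricted cs P hgt x y) (hy : hgt (cs.simple b • y) ≤ hgt y) :
    BruhatLERestricted cs P hgt (cs.simple b • x) y := by
  induction h using Relation.ReflTransGen.head_induction_on with
  | refl => exact self_simple_smul hqp hb hy
  | head hstep htail ih =>
    rcases eq_or_smul_step hqp hb hstep with rfl | hstep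
    · exact htail
    · exact .head hstep ih

/-- Lifting property: a simple reflection weakly raising `x` can be applied to `y` in `x ≤ y`. -/
theorem le_smul (hqp : IsQuasiparabolic cs hgt) (hb : cs.simple b ∈ P)
    (h : BruhatLERestricted cs P hgt x y) (hx : hgt x ≤ hgt (cs.simple b • x)) :
    BruhatLERestricted cs P hgt x (cs.simple b • y) := by
  induction h with
  | refl => exact simple_smul_self hqp hb hx
  | tail hinit hstep ih =>
    rcases eq_or_smul_step hqp hb hstep with rfl | hstep
    · rw [smul_smul, cs.simple_mul_simple_self, one_smul]
      exact hinit
    · exact .tail ih hstep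

/-- An element that no simple reflection in `I` lowers is the least element of its orbit under the
standard parabolic subgroup generated by `I`. -/
theorem of_forall_hgt_le (hqp : IsQuasiparabolic cs hgt) {I : Set B}
    (hmin : ∀ b ∈ I, hgt x ≤ hgt (cs.simple b • x)) {w : W}
    (hw : w ∈ Subgroup.closure (cs.simple '' I)) :
    BruhatLERestricted cs (Subgroup.closure (cs.simple '' I)) hgt x (w • x) := by
  induction hw using Subgroup.closure_induction_left with
  | one => rw [one_smul]; exact .refl
  | mul_left s hs w _ ih =>
    obtain ⟨b, hb, rfl⟩ := hs
    rw [mul_smul]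
    exact le_smul hqp (Subgroup.subset_closure ⟨b, hb, rfl⟩) ih (hmin b hb)
  | inv_mul_cancel s hs w _ ih =>
    obtain ⟨b, hb, rfl⟩ := hs
    rw [mul_smul, cs.inv_simple]
    exact le_smul hqp (Subgroup.subset_closure ⟨b, hb, rfl⟩) ih (hmin b hb)

/-- Two elements of an orbit of a standard parabolic subgroup with heights bounded below are
comparable in the restricted Bruhat order if they are comparable in the full one. -/
theorem of_top (hqp : IsQuasiparabolic cs hgt) {I : Set B} {m : ℤ}
    (hm : ∀ w ∈ Subgroup.closure (cs.simple '' I), m ≤ hgt (w • y)) {w : W}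
    (hw : w ∈ Subgroup.closure (cs.simple '' I)) (hwy : w • y = x)
    (h : BruhatLERestricted cs ⊤ hgt x y) :
    BruhatLERestricted cs (Subgroup.closure (cs.simple '' I)) hgt x y := by
  induction hn : (hgt y - m).toNat using Nat.strong_induction_on generalizing x y w with
  | _ n ih =>
  by_cases hmin : ∀ b ∈ I, hgt y ≤ hgt (cs.simple b • y)
  · have hyx := of_forall_hgt_le hqp hmin hw
    rw [hwy] at hyx
    rcases h.eq_or_hgt_lt with rfl | hxy
    · exact .refl
    rcases hyx.eq_or_hgt_lt with rfl | hyx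
    · exact .refl
    · exact absurd hxy hyx.not_gt
  push Not at hmin
  obtain ⟨b, hbI, hlt⟩ := hmin
  have hb : cs.simple b ∈ Subgroup.closure (cs.simple '' I) :=
    Subgroup.subset_closure ⟨b, hbI, rfl⟩
  have hsy : BruhatLERestricted cs (Subgroup.closure (cs.simple '' I)) hgt (cs.simple b • y) y :=
    self_simple_smul hqp hb hlt.le
  have hm' : ∀ v ∈ Subgroup.closure (cs.simple '' I), m ≤ hgt (v • cs.simple b • y) := by
    intro v hv
    rw [smul_smul]
    exact hm _ (mul_mem hv hb)
  have hlt' : (hgt (cs.simple b • y) - m).toNat < n := by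
    have := hm _ hb
    omega
  rcases le_total (hgt x) (hgt (cs.simple b • x)) with hx | hx
  · exact (ih _ hlt' hm' (mul_mem hw hb) (by simp [smul_smul, ← hwy])
      (le_smul hqp (Subgroup.mem_top _) h hx) rfl).trans hsy
  · have hsx : BruhatLERestricted cs ⊤ hgt (cs.simple b • x) (cs.simple b • y) :=
      le_smul hqp (Subgroup.mem_top _) ((self_simple_smul hqp (Subgroup.mem_top _) hx).trans h)
        (by simpa [smul_smul])
    have hres := (ih _ hlt' hm' (mul_mem (mul_mem hb hw) hb)
      (by simp [smul_smul, ← hwy]) hsx rfl).trans hsy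
    simpa [smul_smul] using smul_le hqp hb hres hlt.le

end BruhatLERestricted

/-- if `x, y` lie in the same orbit of a standard parabolic subgroup
`W_I` and that orbit has heights bounded below, then `x ≤ y` in the Bruhat order of
`X` iff `x ≤ y` in the Bruhat order of the restriction to `W_I`. -/
theorem bruhat_restrict_parabolic (cs : CoxeterSystem M W) {X : Type*} [MulAction W X]
    (hgt : X → ℤ) (hqp : IsQuasiparabolic cs hgt) (I : Set B) (x y : X)
    (horbit : ∃ w ∈ Subgroup.closure (cs.simple '' I), w • x = y)
    (hbdd : ∃ m : ℤ, ∀ w ∈ Subgroup.closure (cs.simple '' I), m ≤ hgt (w • x)) :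
    BruhatLE cs hgt x y ↔
      BruhatLERestricted cs (Subgroup.closure (cs.simple '' I)) hgt x y := by
  obtain ⟨w, hw, rfl⟩ := horbit
  obtain ⟨m, hm⟩ := hbdd
  rw [← bruhatLERestricted_top]
  refine ⟨fun h => ?_, fun h => h.mono le_top⟩
  refine .of_top hqp (m := m) (fun v hv => ?_) (inv_mem hw) (inv_smul_smul w x) h
  rw [smul_smul]
  exact hm _ (mul_mem hv hw)
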